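/- Let 0 < λ ≤ 1 and let f ∈ 𝒢(λ) with f' not identically equal to 1. Then there exists an integer n ≥ 1 such that the analytic function z ↦ f(z)/z (extended by value 1 at z = 0) is subordinate on 𝔻 to the analytic function h_n(z) = (1/z) ∫₀^z (1 + t^n)^{λ/n} dt (extended by value 1 at z = 0). -/

import Mathlib

open Complex Metric intervalIntegral

/-- `p ≺ q` on the unit disk: there is an analytic `ω : 𝔻 → 𝔻` with `ω 0 = 0`
and `p = q ∘ ω` on `𝔻`. -/
def Subord (p q : ℂ → ℂ) : Prop :=
  ∃ ω : ℂ → ℂ, DifferentiableOn ℂ ω (ball 0 1) ∧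
    Set.MapsTo ω (ball 0 1) (ball 0 1) ∧ ω 0 = 0 ∧
    ∀ z ∈ ball (0:ℂ) 1, p z = q (ω z)

/-- The complex line integral of `F` along the segment from `0` to `z`,
parametrized as `z · ∫_0^1 F(s z) ds`. -/
noncomputable def segIntegral (F : ℂ → ℂ) (z : ℂ) : ℂ :=
  z * ∫ s in (0:ℝ)..1, F ((s : ℂ) * z)

/-- `h_n(z) = (1/z) ∫_0^z (1 + t^n)^{λ/n} dt`, extended by the value `1` at `z = 0`. -/
noncomputable def hFun (lam : ℝ) (n : ℕ) : ℂ → ℂ := fun z =>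
  if z = 0 then 1
  else (segIntegral (fun t => Complex.exp (((lam / n : ℝ) : ℂ) * Complex.log (1 + t ^ n))) z) / z

/-- At a point where the real part of a holomorphic function is maximal over the closed disk
through that point, the radial derivative is real and nonnegative. -/
lemma exists_nonneg_of_re_le {q : ℂ → ℂ} {c z₀ : ℂ} (hq : HasDerivAt q c z₀)
    (hmax : ∀ z, ‖z‖ ≤ ‖z₀‖ → (q z).re ≤ (q z₀).re) : ∃ m : ℝ, 0 ≤ m ∧ z₀ * c = m := by
  have key : ∀ y : ℂ, ‖y‖ ≤ ‖z₀‖ → (c * (y - z₀)).re ≤ 0 := by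
    intro y hy
    have hF : HasFDerivAt (fun z => (q z).re)
        (reCLM.comp ((ContinuousLinearMap.toSpanSingleton ℂ c).restrictScalars ℝ)) z₀ :=
      reCLM.hasFDerivAt.comp z₀ (hq.hasFDerivAt.restrictScalars ℝ)
    have hloc : IsLocalMaxOn (fun z => (q z).re) (closedBall 0 ‖z₀‖) z₀ := by
      refine IsMaxOn.localize fun z hz => ?_
      exact hmax z (by simpa using hz)
    have hseg : segment ℝ z₀ y ⊆ closedBall (0 : ℂ) ‖z₀‖ :=
      (convex_closedBall (0 : ℂ) ‖z₀‖).segment_subset (by simp) (by simpa using hy)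
    have := hloc.hasFDerivWithinAt_nonpos hF.hasFDerivWithinAt
      (sub_mem_posTangentConeAt_of_segment_subset hseg)
    simpa [mul_comm] using this
  rcases eq_or_ne c 0 with rfl | hc
  · exact ⟨0, le_rfl, by simp⟩
  have hc' : (‖c‖ : ℂ) ≠ 0 := by simpa using hc
  refine ⟨‖z₀ * c‖, norm_nonneg _, ?_⟩
  have h := key (‖z₀‖ * (starRingEnd ℂ c / ‖c‖)) (by simp [hc])
  have e : c * (‖z₀‖ * (starRingEnd ℂ c / ‖c‖) - z₀) = (‖z₀ * c‖ : ℂ) - z₀ * c := by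
    rw [mul_sub, norm_mul]
    have : c * (‖z₀‖ * (starRingEnd ℂ c / ‖c‖)) = ‖z₀‖ * (c * starRingEnd ℂ c) / ‖c‖ := by ring
    rw [this, mul_conj']
    push_cast
    field_simp
  rw [e] at h
  generalize z₀ * c = w at h ⊢
  have h1 : ‖w‖ ≤ w.re := by simpa using h
  have h2 := abs_re_eq_norm.1 (le_antisymm (abs_re_le_norm w) (h1.trans (le_abs_self _)))
  have h3 := le_antisymm h1 (re_le_norm _)
  apply Complex.ext
  · simpa using h3.symm
  · simpa using h2

/-- **Jack's lemma**. -/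
lemma exists_jack_point {φ : ℂ → ℂ} {R r : ℝ} (hφ : DifferentiableOn ℂ φ (ball 0 R))
    (h0 : φ 0 = 0) (hr : 0 < r) (hrR : r < R) :
    ∃ z₁, ‖z₁‖ = r ∧ (∀ z, ‖z‖ ≤ r → ‖φ z‖ ≤ ‖φ z₁‖) ∧
      (φ z₁ ≠ 0 → ∃ m : ℝ, 1 ≤ m ∧ z₁ * deriv φ z₁ = m * φ z₁) := by
  have hsub : closedBall (0 : ℂ) r ⊆ ball 0 R := closedBall_subset_ball hrR
  have hcont : ContinuousOn φ (closedBall 0 r) := hφ.continuousOn.mono hsub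
  obtain ⟨z₁, hz₁, hmax⟩ := (isCompact_sphere (0 : ℂ) r).exists_isMaxOn
    (NormedSpace.sphere_nonempty.2 hr.le) (hcont.mono sphere_subset_closedBall).norm
  have hz₁r : ‖z₁‖ = r := by simpa using hz₁
  have hle : ∀ z, ‖z‖ ≤ r → ‖φ z‖ ≤ ‖φ z₁‖ := by
    intro z hz
    refine norm_le_of_forall_mem_frontier_norm_le (U := ball 0 r) isBounded_ball ?_ ?_ ?_
    · refine ⟨hφ.mono (ball_subset_ball hrR.le), ?_⟩
      rwa [closure_ball _ hr.ne']
    · intro w hw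
      rw [frontier_ball _ hr.ne'] at hw
      exact hmax hw
    · rw [closure_ball _ hr.ne']
      simpa using hz
  refine ⟨z₁, hz₁r, hle, fun hW => ?_⟩
  have hz₁0 : z₁ ≠ 0 := by
    rintro rfl
    exact hW h0
  have hschwarz : ∀ z, ‖z‖ ≤ r → ‖φ z‖ ≤ ‖φ z₁‖ / r * ‖z‖ := by
    intro z hz
    rcases hz.eq_or_lt with h | h
    · rw [h, div_mul_cancel₀ _ hr.ne']
      exact hle z hz
    · have := dist_le_div_mul_dist_of_mapsTo_ball (R₂ := ‖φ z₁‖)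
        (hφ.mono (ball_subset_ball hrR.le)) (fun w hw => ?_) (mem_ball_zero_iff.2 h)
      · simpa [h0] using this
      · have hw' : ‖w‖ < r := by simpa using hw
        simpa [h0] using hle w hw'.le
  have hd : HasDerivAt φ (deriv φ z₁) z₁ :=
    (hφ.differentiableAt (isOpen_ball.mem_nhds (hsub (by simp [hz₁r])))).hasDerivAt
  have hq := (hd.div (hasDerivAt_id z₁) hz₁0).mul_const (z₁ / φ z₁)
  obtain ⟨m, hm, hme⟩ := exists_nonneg_of_re_le hq (fun z hz => by
    have h1 : φ z₁ / z₁ * (z₁ / φ z₁) = 1 := by field_simp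
    refine (re_le_norm _).trans ?_
    simp only [id, Pi.div_apply, h1, norm_mul, norm_div, one_re]
    rcases eq_or_ne z 0 with rfl | hz0
    · simp
    rw [hz₁r] at hz ⊢
    have hn : 0 < ‖φ z₁‖ := norm_pos_iff.2 hW
    have hn' : 0 < ‖z‖ := norm_pos_iff.2 hz0
    rw [div_mul_div_comm, div_le_one (by positivity)]
    have := hschwarz z hz
    rw [div_mul_eq_mul_div, le_div_iff₀ hr] at this
    linarith)
  refine ⟨m + 1, by linarith, ?_⟩
  push_cast
  rw [← hme]
  simp only [id]
  field_simp
  ring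

/-- The principal branch of `(1 + w) ^ μ`. -/
noncomputable def powOneAdd (μ : ℝ) (w : ℂ) : ℂ := exp (μ * log (1 + w))

lemma one_add_re_pos {w : ℂ} (hw : ‖w‖ < 1) : 0 < (1 + w).re := by
  have := (abs_re_le_norm w).trans_lt hw
  rw [abs_lt] at this
  simp only [add_re, one_re]
  linarith [this.1]

lemma abs_arg_one_add_lt {w : ℂ} (hw : ‖w‖ < 1) : |arg (1 + w)| < Real.pi / 2 :=
  abs_arg_lt_pi_div_two_iff.2 (Or.inl (one_add_re_pos hw))

lemma powOneAdd_ne_zero (μ : ℝ) (w : ℂ) : powOneAdd μ w ≠ 0 := exp_ne_zero _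

lemma powOneAdd_eq_mul {μ : ℝ} {w : ℂ} (hw : ‖w‖ < 1) :
    powOneAdd μ w = (1 + w) * powOneAdd (μ - 1) w := by
  have h : 1 + w ≠ 0 := fun h => by simpa [h] using one_add_re_pos hw
  unfold powOneAdd
  nth_rw 2 [← exp_log h]
  rw [← exp_add]
  push_cast
  ring_nf

lemma hasDerivAt_powOneAdd (μ : ℝ) {w : ℂ} (hw : ‖w‖ < 1) :
    HasDerivAt (powOneAdd μ) (μ * powOneAdd (μ - 1) w) w := by
  have hs := mem_slitPlane_of_norm_lt_one hw
  have h : 1 + w ≠ 0 := slitPlane_ne_zero hs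
  have := ((((hasDerivAt_id w).const_add 1).clog hs).const_mul (μ : ℂ)).cexp
  refine HasDerivAt.congr_deriv this ?_
  change powOneAdd μ w * _ = _
  rw [powOneAdd_eq_mul hw]
  simp only [id]
  field_simp

/-- Equality of outer normal directions of `(1 + w) ^ μ` on a circle forces equality of points. -/
lemma eq_of_normal_eq {μ : ℝ} (h0 : 0 < μ) (h1 : μ ≤ 1) {v w : ℂ} (hw : ‖w‖ < 1) (hw0 : w ≠ 0)
    (hvw : ‖v‖ = ‖w‖) {c : ℝ} (hc : 0 ≤ c)
    (h : v * powOneAdd (μ - 1) v = c * (w * powOneAdd (μ - 1) w)) : v = w := by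
  have hv : ‖v‖ < 1 := hvw ▸ hw
  have hv0 : v ≠ 0 := norm_pos_iff.1 (hvw ▸ norm_pos_iff.2 hw0)
  have hv1 : 1 + v ≠ 0 := slitPlane_ne_zero (mem_slitPlane_of_norm_lt_one hv)
  have hw1 : 1 + w ≠ 0 := slitPlane_ne_zero (mem_slitPlane_of_norm_lt_one hw)
  have hc0 : c ≠ 0 := by
    rintro rfl
    simp [hv0, powOneAdd_ne_zero] at h
  replace hc : 0 < c := lt_of_le_of_ne hc hc0.symm
  set l := log (1 + v) - log (1 + w) with hl
  have hX : 1 + v = (1 + w) * exp l := by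
    rw [hl, exp_sub, exp_log hv1, exp_log hw1]
    field_simp
  have hY : v = c * w * exp (((1 - μ : ℝ) : ℂ) * l) := by
    have e : exp (((1 - μ : ℝ) : ℂ) * l) = powOneAdd (μ - 1) w / powOneAdd (μ - 1) v := by
      unfold powOneAdd
      rw [← exp_sub, hl]
      push_cast
      ring_nf
    rw [e]
    field_simp [powOneAdd_ne_zero]
    rw [h]
    ring
  have him : |l.im| < Real.pi := by
    have a := abs_arg_one_add_lt hv
    have b := abs_arg_one_add_lt hw
    rw [hl, sub_im, log_im, log_im]
    rw [abs_lt] at a b ⊢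
    constructor <;> linarith [a.1, a.2, b.1, b.2]
  rw [abs_lt] at him
  -- compare the signs of three imaginary parts
  have hsq : v.re ^ 2 + v.im ^ 2 = w.re ^ 2 + w.im ^ 2 := by
    have : normSq v = normSq w := by rw [normSq_eq_norm_sq, normSq_eq_norm_sq, hvw]
    simp only [normSq_apply] at this
    linarith
  have hlt : w.re ^ 2 + w.im ^ 2 < 1 := by
    have : normSq w < 1 := by
      rw [normSq_eq_norm_sq]
      nlinarith [norm_nonneg w]
    simp only [normSq_apply] at this
    linarith
  have hpos : 0 < w.re ^ 2 + w.im ^ 2 := by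
    have := normSq_pos.2 hw0
    simp only [normSq_apply] at this
    linarith
  have hpos1 : 0 < normSq (1 + w) := normSq_pos.2 hw1
  have hA : ((1 + v) * (starRingEnd ℂ) (1 + w)).im
      = normSq (1 + w) * Real.exp l.re * Real.sin l.im := by
    have : (1 + v) * (starRingEnd ℂ) (1 + w) = (normSq (1 + w) : ℂ) * exp l := by
      rw [hX, ← mul_conj]
      ring
    rw [this, im_ofReal_mul, exp_im]
    ring
  have hB : (v * (starRingEnd ℂ) w).im
      = normSq w * c * Real.exp ((1 - μ) * l.re) * Real.sin ((1 - μ) * l.im) := by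
    have : v * (starRingEnd ℂ) w = ((normSq w * c : ℝ) : ℂ) * exp (((1 - μ : ℝ) : ℂ) * l) := by
      conv_lhs => rw [hY]
      push_cast
      rw [← mul_conj]
      ring
    rw [this, im_ofReal_mul, exp_im, re_ofReal_mul, im_ofReal_mul]
    ring
  have hC : (((1 + v) * (starRingEnd ℂ) (1 + w)) * (starRingEnd ℂ) (v * (starRingEnd ℂ) w)).im
      = normSq (1 + w) * Real.exp l.re * (normSq w * c * Real.exp ((1 - μ) * l.re))
        * Real.sin (μ * l.im) := by
    have e1 : (1 + v) * (starRingEnd ℂ) (1 + w) = (normSq (1 + w) : ℂ) * exp l := by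
      rw [hX, ← mul_conj]
      ring
    have e2 : v * (starRingEnd ℂ) w = ((normSq w * c : ℝ) : ℂ) * exp (((1 - μ : ℝ) : ℂ) * l) := by
      conv_lhs => rw [hY]
      push_cast
      rw [← mul_conj]
      ring
    have e3 : μ * l.im = l.im - (1 - μ) * l.im := by ring
    rw [e1, e2, e3, Real.sin_sub]
    simp only [mul_im, mul_re, conj_re, conj_im, ofReal_re, ofReal_im, exp_re, exp_im, zero_mul,
      sub_zero, add_zero]
    ring
  have hnw : 0 < normSq w := normSq_pos.2 hw0
  have hrel : (((1 + v) * (starRingEnd ℂ) (1 + w)) * (starRingEnd ℂ) (v * (starRingEnd ℂ) w)).im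
      = -((w.re ^ 2 + w.im ^ 2) * ((1 + v) * (starRingEnd ℂ) (1 + w)).im
        + (1 - (w.re ^ 2 + w.im ^ 2)) * (v * (starRingEnd ℂ) w).im) := by
    simp only [mul_re, mul_im, add_re, add_im, one_re, one_im, conj_re, conj_im]
    linear_combination w.im * hsq
  rw [hA, hB, hC] at hrel
  set a := normSq (1 + w) * Real.exp l.re
  set b := normSq w * c * Real.exp ((1 - μ) * l.re)
  have ha0 : 0 < a := by positivity
  have hb0 : 0 < b := by positivity
  set ρ := w.re ^ 2 + w.im ^ 2
  rcases lt_trichotomy l.im 0 with hlt0 | heq0 | hgt0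
  · exfalso
    have s1 : Real.sin l.im < 0 := Real.sin_neg_of_neg_of_neg_pi_lt hlt0 him.1
    have s2 : Real.sin ((1 - μ) * l.im) ≤ 0 :=
      Real.sin_nonpos_of_nonpos_of_neg_pi_le (by nlinarith) (by nlinarith)
    have s3 : Real.sin (μ * l.im) < 0 :=
      Real.sin_neg_of_neg_of_neg_pi_lt (by nlinarith) (by nlinarith)
    have t1 : ρ * (a * Real.sin l.im) < 0 :=
      mul_neg_of_pos_of_neg hpos (mul_neg_of_pos_of_neg ha0 s1)
    have t2 : (1 - ρ) * (b * Real.sin ((1 - μ) * l.im)) ≤ 0 :=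
      mul_nonpos_of_nonneg_of_nonpos (by linarith) (mul_nonpos_of_nonneg_of_nonpos hb0.le s2)
    have t3 : a * b * Real.sin (μ * l.im) < 0 := mul_neg_of_pos_of_neg (mul_pos ha0 hb0) s3
    linarith
  · have hvk : v = ((c * Real.exp ((1 - μ) * l.re) : ℝ) : ℂ) * w := by
      have hlr : l = (l.re : ℂ) := by apply Complex.ext <;> simp [heq0]
      rw [hlr] at hY
      rw [hY]
      push_cast
      ring
    have hk : 0 < c * Real.exp ((1 - μ) * l.re) := by positivity
    have hn := congrArg norm hvk
    rw [norm_mul, norm_real, Real.norm_of_nonneg hk.le, hvw] at hn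
    have hk1 : c * Real.exp ((1 - μ) * l.re) = 1 := by
      have := norm_pos_iff.2 hw0
      field_simp at hn
      linarith
    rw [hvk, hk1, ofReal_one, one_mul]
  · exfalso
    have s1 : 0 < Real.sin l.im := Real.sin_pos_of_pos_of_lt_pi hgt0 him.2
    have s2 : 0 ≤ Real.sin ((1 - μ) * l.im) :=
      Real.sin_nonneg_of_nonneg_of_le_pi (by nlinarith) (by nlinarith)
    have s3 : 0 < Real.sin (μ * l.im) :=
      Real.sin_pos_of_pos_of_lt_pi (by nlinarith) (by nlinarith)
    have t2 : 0 ≤ (1 - ρ) * (b * Real.sin ((1 - μ) * l.im)) :=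
      mul_nonneg (by linarith) (by positivity)
    have : 0 < ρ * (a * Real.sin l.im) := by positivity
    have : 0 < a * b * Real.sin (μ * l.im) := by positivity
    linarith

/-- The image of a disk under `(1 + w) ^ μ` lies strictly on one side of each of the tangent
lines of its boundary. -/
lemma re_powOneAdd_div_lt {μ : ℝ} (h0 : 0 < μ) (h1 : μ ≤ 1) {v w : ℂ} (hw : ‖w‖ < 1)
    (hvw : ‖v‖ < ‖w‖) :
    (powOneAdd μ v / (w * powOneAdd (μ - 1) w)).re
      < (powOneAdd μ w / (w * powOneAdd (μ - 1) w)).re := by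
  have hw0 : w ≠ 0 := norm_pos_iff.1 ((norm_nonneg _).trans_lt hvw)
  set e := w * powOneAdd (μ - 1) w with he
  have he0 : e ≠ 0 := mul_ne_zero hw0 (powOneAdd_ne_zero _ _)
  have hder : ∀ z : ℂ, ‖z‖ ≤ ‖w‖ → HasDerivAt (fun z => powOneAdd μ z / e)
      (μ * powOneAdd (μ - 1) z / e) z := fun z hz =>
    (hasDerivAt_powOneAdd μ (hz.trans_lt hw)).div_const e
  obtain ⟨u, hu, hmax⟩ := (isCompact_closedBall (0 : ℂ) ‖w‖).exists_isMaxOn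
    (f := fun z => (powOneAdd μ z / e).re) ⟨0, by simp⟩
    (fun z hz => (continuous_re.continuousAt.comp
      (hder z (by simpa using hz)).continuousAt).continuousWithinAt)
  -- a maximum cannot be attained in the interior
  have hint : ∀ z, ‖z‖ < ‖w‖ →
      (powOneAdd μ z / e).re < (powOneAdd μ u / e).re := by
    intro z hz
    refine lt_of_le_of_ne (hmax (by simpa using hz.le)) fun heq => ?_
    have hloc : ∀ y, ‖y‖ ≤ ‖w‖ → (powOneAdd μ y / e).re ≤ (powOneAdd μ z / e).re := by
      intro y hy
      rw [heq]
      exact hmax (by simpa using hy)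
    have hloc' : IsLocalMax (fun y => (powOneAdd μ y / e).re) z := by
      filter_upwards [isOpen_ball.mem_nhds (mem_ball_zero_iff.2 hz)] with y hy
      exact hloc y (mem_ball_zero_iff.1 hy).le
    have hF : HasFDerivAt (fun y => (powOneAdd μ y / e).re)
        (reCLM.comp ((ContinuousLinearMap.toSpanSingleton ℂ
          (μ * powOneAdd (μ - 1) z / e)).restrictScalars ℝ)) z :=
      reCLM.hasFDerivAt.comp z ((hder z hz.le).hasFDerivAt.restrictScalars ℝ)
    set d := μ * powOneAdd (μ - 1) z / e
    have hd0 : d ≠ 0 :=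
      div_ne_zero (mul_ne_zero (by simpa using h0.ne') (powOneAdd_ne_zero _ _)) he0
    have := congrArg (fun L : ℂ →L[ℝ] ℝ => L ((starRingEnd ℂ) d)) (hloc'.hasFDerivAt_eq_zero hF)
    simp at this
    apply hd0
    rw [← normSq_eq_zero, normSq_apply]
    linarith
  have hun : ‖u‖ = ‖w‖ := by
    refine le_antisymm (by simpa using hu) (not_lt.1 fun h => ?_)
    exact lt_irrefl _ (hint u h)
  obtain ⟨c, hc, hce⟩ := exists_nonneg_of_re_le (hder u hun.le) (fun z hz =>
    hmax (by simpa [hun] using hz))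
  have huw : u = w := by
    refine eq_of_normal_eq h0 h1 hw hw0 hun (c := c / μ) (by positivity) ?_
    have hμ : (μ : ℂ) ≠ 0 := by simpa using h0.ne'
    push_cast
    rw [← hce, ← he]
    field_simp
  rw [huw] at hint
  exact hint v hvw

/-- The mean of `(1 + t) ^ μ` over the segment from `0` to `w`. -/
noncomputable def powAvg (μ : ℝ) (w : ℂ) : ℂ := ∫ s in (0 : ℝ)..1, powOneAdd μ (s * w)

/-- The derivative of `powAvg`. -/
noncomputable def powAvgDeriv (μ : ℝ) (w : ℂ) : ℂ :=
  ∫ s in (0 : ℝ)..1, s * (μ * powOneAdd (μ - 1) (s * w))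

lemma norm_ofReal_mul_le {s : ℝ} (hs : s ∈ Set.Icc (0 : ℝ) 1) (w : ℂ) : ‖(s : ℂ) * w‖ ≤ ‖w‖ := by
  rw [norm_mul, norm_real, Real.norm_of_nonneg hs.1]
  exact mul_le_of_le_one_left (norm_nonneg _) hs.2

lemma continuousOn_powOneAdd (μ : ℝ) : ContinuousOn (powOneAdd μ) (ball 0 1) := fun _ hz =>
  (hasDerivAt_powOneAdd μ (mem_ball_zero_iff.1 hz)).continuousAt.continuousWithinAt

lemma continuousOn_powOneAdd_segment (μ : ℝ) {w : ℂ} (hw : ‖w‖ < 1) :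
    ContinuousOn (fun s : ℝ => powOneAdd μ (s * w)) (Set.uIcc 0 1) := by
  refine (continuousOn_powOneAdd μ).comp (by fun_prop) fun s hs => ?_
  rw [Set.uIcc_of_le zero_le_one] at hs
  exact mem_ball_zero_iff.2 ((norm_ofReal_mul_le hs w).trans_lt hw)

lemma continuousOn_powAvgDeriv_integrand (μ : ℝ) {w : ℂ} (hw : ‖w‖ < 1) :
    ContinuousOn (fun s : ℝ => s * (μ * powOneAdd (μ - 1) (s * w))) (Set.uIcc 0 1) :=
  continuous_ofReal.continuousOn.mul
    (continuousOn_const.mul (continuousOn_powOneAdd_segment (μ - 1) hw))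

lemma hasDerivAt_powAvg (μ : ℝ) {w : ℂ} (hw : ‖w‖ < 1) :
    HasDerivAt (powAvg μ) (powAvgDeriv μ w) w := by
  obtain ⟨R, hwR, hR1⟩ := exists_between hw
  have hcont : ContinuousOn (fun z => μ * powOneAdd (μ - 1) z) (closedBall 0 R) :=
    continuousOn_const.mul ((continuousOn_powOneAdd (μ - 1)).mono (closedBall_subset_ball hR1))
  obtain ⟨C, hC⟩ := (isCompact_closedBall (0 : ℂ) R).exists_bound_of_continuousOn hcont
  have hIoc : ∀ s : ℝ, s ∈ Set.uIoc (0 : ℝ) 1 → s ∈ Set.Icc (0 : ℝ) 1 := fun s hs => by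
    rw [Set.uIoc_of_le zero_le_one] at hs
    exact ⟨hs.1.le, hs.2⟩
  have hn : ball (0 : ℂ) R ∈ nhds w := isOpen_ball.mem_nhds (mem_ball_zero_iff.2 hwR)
  refine (intervalIntegral.hasDerivAt_integral_of_dominated_loc_of_deriv_le (bound := fun _ => C)
    (F := fun z s => powOneAdd μ (s * z))
    (F' := fun z s => s * (μ * powOneAdd (μ - 1) (s * z))) hn ?_ ?_ ?_ ?_ ?_ ?_).2
  · filter_upwards [hn] with z hz
    exact (intervalIntegrable_iff.1 (continuousOn_powOneAdd_segment μ
      ((mem_ball_zero_iff.1 hz).trans hR1)).intervalIntegrable).aestronglyMeasurable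
  · exact (continuousOn_powOneAdd_segment μ hw).intervalIntegrable
  · exact (intervalIntegrable_iff.1
      (continuousOn_powAvgDeriv_integrand μ hw).intervalIntegrable).aestronglyMeasurable
  · refine Filter.Eventually.of_forall fun s hs z hz => ?_
    have hs' := hIoc s hs
    have h1 := norm_ofReal_mul_le hs' z
    have h2 := norm_ofReal_mul_le hs' (μ * powOneAdd (μ - 1) (s * z))
    exact h2.trans (hC _ (mem_closedBall_zero_iff.2 (h1.trans (mem_ball_zero_iff.1 hz).le)))
  · exact intervalIntegrable_const
  · refine Filter.Eventually.of_forall fun s hs z hz => ?_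
    have h1 := (norm_ofReal_mul_le (hIoc s hs) z).trans_lt ((mem_ball_zero_iff.1 hz).trans hR1)
    have := (hasDerivAt_powOneAdd μ h1).comp z ((hasDerivAt_id z).const_mul (s : ℂ))
    exact this.congr_deriv (by ring)

lemma powAvg_add_mul_deriv (μ : ℝ) {w : ℂ} (hw : ‖w‖ < 1) :
    powAvg μ w + w * powAvgDeriv μ w = powOneAdd μ w := by
  have hi := (continuousOn_powOneAdd_segment μ hw).intervalIntegrable (μ := MeasureTheory.volume)
  have hi' := (continuousOn_powAvgDeriv_integrand μ hw).intervalIntegrable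
    (μ := MeasureTheory.volume)
  have hd : ∀ s ∈ Set.uIcc (0 : ℝ) 1, HasDerivAt (fun s : ℝ => (s : ℂ) * powOneAdd μ (s * w))
      (powOneAdd μ (s * w) + w * (s * (μ * powOneAdd (μ - 1) (s * w)))) s := by
    intro s hs
    rw [Set.uIcc_of_le zero_le_one] at hs
    have h1 := (norm_ofReal_mul_le hs w).trans_lt hw
    have h2 := (hasDerivAt_powOneAdd μ h1).comp (s : ℂ) ((hasDerivAt_id (s : ℂ)).mul_const w)
    exact ((hasDerivAt_id (s : ℂ)).mul h2).comp_ofReal.congr_deriv (by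
      simp only [id, Function.comp]
      ring)
  have := integral_eq_sub_of_hasDerivAt hd (hi.add (hi'.const_mul w))
  rw [integral_add hi (hi'.const_mul w), integral_const_mul] at this
  simpa [powAvg, powAvgDeriv] using this

lemma exp_re_pos_of_abs_im_lt {z : ℂ} (hz : |z.im| < Real.pi / 2) : 0 < (exp z).re := by
  rw [exp_re]
  rw [abs_lt] at hz
  exact mul_pos (Real.exp_pos _) (Real.cos_pos_of_mem_Ioo ⟨hz.1, hz.2⟩)

lemma re_powAvgDeriv_div_pos {μ : ℝ} (h0 : 0 < μ) {w : ℂ} (hw : ‖w‖ < 1) {e : ℂ}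
    (h : ∀ s ∈ Set.Ioo (0 : ℝ) 1, 0 < (powOneAdd (μ - 1) (s * w) / e).re) :
    0 < (powAvgDeriv μ w / e).re := by
  have hc : ContinuousOn (fun s : ℝ => s * (μ * powOneAdd (μ - 1) (s * w)) / e) (Set.uIcc 0 1) :=
    (continuousOn_powAvgDeriv_integrand μ hw).div_const e
  have hre := reCLM.intervalIntegral_comp_comm
    (hc.intervalIntegrable (μ := MeasureTheory.volume))
  rw [powAvgDeriv, ← integral_div]
  simp only [reCLM_apply] at hre
  rw [← hre]
  refine intervalIntegral_pos_of_pos_on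
    (continuous_re.comp_continuousOn hc).intervalIntegrable (fun s hs => ?_) zero_lt_one
  have : (s : ℂ) * (μ * powOneAdd (μ - 1) (s * w)) / e
      = ((s * μ : ℝ) : ℂ) * (powOneAdd (μ - 1) (s * w) / e) := by
    push_cast
    ring
  rw [this, re_ofReal_mul]
  exact mul_pos (mul_pos hs.1 h0) (h s hs)

lemma re_powAvgDeriv_pos {μ : ℝ} (h0 : 0 < μ) (h1 : μ ≤ 1) {w : ℂ} (hw : ‖w‖ < 1) :
    0 < (powAvgDeriv μ w).re := by
  rw [← div_one (powAvgDeriv μ w)]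
  refine re_powAvgDeriv_div_pos h0 hw fun s hs => ?_
  rw [div_one]
  have ha := abs_arg_one_add_lt
    ((norm_ofReal_mul_le (Set.Ioo_subset_Icc_self hs) w).trans_lt hw)
  refine exp_re_pos_of_abs_im_lt ?_
  rw [im_ofReal_mul, log_im, abs_mul, abs_of_nonpos (by linarith)]
  nlinarith [abs_nonneg (arg (1 + s * w))]

lemma re_powAvgDeriv_div_powOneAdd_pos {μ : ℝ} (h0 : 0 < μ) (h1 : μ ≤ 1) {w : ℂ} (hw : ‖w‖ < 1) :
    0 < (powAvgDeriv μ w / powOneAdd (μ - 1) w).re := by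
  refine re_powAvgDeriv_div_pos h0 hw fun s hs => ?_
  have ha := abs_arg_one_add_lt
    ((norm_ofReal_mul_le (Set.Ioo_subset_Icc_self hs) w).trans_lt hw)
  have hb := abs_arg_one_add_lt hw
  have hab : |arg (1 + w) - arg (1 + s * w)| < Real.pi / 2 := by
    rw [abs_lt] at ha hb ⊢
    have him : (1 + s * w).im = s * w.im := by simp
    have him' : (1 + w).im = w.im := by simp
    rcases le_or_gt 0 w.im with h | h
    · have a := arg_nonneg_iff.2 (him ▸ mul_nonneg hs.1.le h)
      have b := arg_nonneg_iff.2 (him' ▸ h)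
      constructor <;> linarith
    · have a := arg_neg_iff.2 (him ▸ mul_neg_of_pos_of_neg hs.1 h)
      have b := arg_neg_iff.2 (him' ▸ h)
      constructor <;> linarith
  unfold powOneAdd
  rw [← exp_sub]
  refine exp_re_pos_of_abs_im_lt ?_
  rw [sub_im, im_ofReal_mul, im_ofReal_mul, log_im, log_im]
  have : (μ - 1) * arg (1 + s * w) - (μ - 1) * arg (1 + w)
      = (1 - μ) * (arg (1 + w) - arg (1 + s * w)) := by ring
  rw [this, abs_mul, abs_of_nonneg (by linarith)]
  nlinarith [abs_nonneg (arg (1 + w) - arg (1 + s * w))]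

/-- **Noshiro–Warschawski**: a function whose derivative has positive real part is injective. -/
lemma injOn_of_re_deriv_pos {F F' : ℂ → ℂ} {U : Set ℂ} (hU : Convex ℝ U)
    (hF : ∀ z ∈ U, HasDerivAt F (F' z) z) (hpos : ∀ z ∈ U, 0 < (F' z).re) : Set.InjOn F U := by
  intro a ha b hb hab
  by_contra hne
  set d := b - a with hd
  have hd0 : d ≠ 0 := sub_ne_zero.2 (Ne.symm hne)
  have hmem : ∀ t ∈ Set.Icc (0 : ℝ) 1, a + t * d ∈ U := by
    intro t ht
    have := hU.add_smul_sub_mem ha hb ht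
    simpa using this
  have hder : ∀ t ∈ Set.Icc (0 : ℝ) 1,
      HasDerivAt (fun t : ℝ => ((starRingEnd ℂ) d * F (a + t * d)).re)
        (normSq d * (F' (a + t * d)).re) t := by
    intro t ht
    have h1 := (hF _ (hmem t ht)).comp (t : ℂ)
      (((hasDerivAt_id (t : ℂ)).mul_const d).const_add a)
    have h2 := (h1.const_mul ((starRingEnd ℂ) d)).real_of_complex
    refine h2.congr_deriv ?_
    rw [← re_ofReal_mul, ← mul_conj]
    congr 1
    ring
  have hmono := strictMonoOn_of_deriv_pos (convex_Icc (0 : ℝ) 1)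
    (fun t ht => (hder t ht).continuousAt.continuousWithinAt) (fun t ht => by
      rw [interior_Icc] at ht
      have ht' := Set.Ioo_subset_Icc_self ht
      rw [(hder t ht').deriv]
      exact mul_pos (normSq_pos.2 hd0) (hpos _ (hmem t ht')))
  have := hmono (Set.left_mem_Icc.2 zero_le_one) (Set.right_mem_Icc.2 zero_le_one) zero_lt_one
  simp [hd, hab] at this

lemma injOn_powAvg {μ : ℝ} (h0 : 0 < μ) (h1 : μ ≤ 1) : Set.InjOn (powAvg μ) (ball 0 1) :=
  injOn_of_re_deriv_pos (convex_ball 0 1)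
    (fun _ hz => hasDerivAt_powAvg μ (mem_ball_zero_iff.1 hz))
    (fun _ hz => re_powAvgDeriv_pos h0 h1 (mem_ball_zero_iff.1 hz))

@[simp]
lemma powAvg_zero (μ : ℝ) : powAvg μ 0 = 1 := by simp [powAvg, powOneAdd]

lemma hFun_one (μ : ℝ) : hFun μ 1 = powAvg μ := by
  funext z
  unfold hFun
  split_ifs with h
  · rw [h, powAvg_zero]
  · rw [segIntegral, mul_div_cancel_left₀ _ h]
    simp [powAvg, powOneAdd]

lemma differentiableAt_invFunOn {F : ℂ → ℂ} {U : Set ℂ} (hU : IsOpen U)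
    (hF : DifferentiableOn ℂ F U) (hinj : Set.InjOn F U) {w : ℂ} (hw : w ∈ U)
    (hd : deriv F w ≠ 0) : DifferentiableAt ℂ (Function.invFunOn F U) (F w) := by
  have hs : HasStrictDerivAt F (deriv F w) w :=
    (hF.analyticAt (hU.mem_nhds hw)).hasStrictDerivAt
  have hl := hs.to_localInverse hd
  have hlw : hs.localInverse F (deriv F w) w hd (F w) = w :=
    HasStrictFDerivAt.localInverse_apply_image _
  refine hl.hasDerivAt.differentiableAt.congr_of_eventuallyEq ?_
  have hU' : ∀ᶠ y in nhds (F w), hs.localInverse F (deriv F w) w hd y ∈ U :=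
    hl.hasDerivAt.continuousAt.eventually_mem (by rw [hlw]; exact hU.mem_nhds hw)
  filter_upwards [hU', hs.eventually_right_inverse hd] with y hy hy'
  conv_lhs => rw [← hy']
  exact hinj.leftInvOn_invFunOn hy

/-- A lift through `powAvg` of a function `p` for which `p + z p'` is a function bounded by the
identity composed with `(1 + w) ^ μ` is itself bounded by the identity. -/
lemma norm_le_of_powAvg_comp {μ : ℝ} (h0 : 0 < μ) (h1 : μ ≤ 1) {R : ℝ} {p φ ω : ℂ → ℂ}
    (hω : DifferentiableOn ℂ ω (ball 0 R)) (hω1 : ∀ z ∈ ball (0 : ℂ) R, ‖ω z‖ < 1)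
    (hω0 : ω 0 = 0) (hp : ∀ z ∈ ball (0 : ℂ) R, p z = powAvg μ (ω z))
    (hφ : ∀ z ∈ ball (0 : ℂ) R, ‖φ z‖ ≤ ‖z‖)
    (hpφ : ∀ z ∈ ball (0 : ℂ) R, p z + z * deriv p z = powOneAdd μ (φ z)) :
    ∀ z ∈ ball (0 : ℂ) R, ‖ω z‖ ≤ ‖z‖ := by
  intro z hz
  by_contra! hlt
  have hz0 : z ≠ 0 := by
    rintro rfl
    simp [hω0] at hlt
  obtain ⟨z₁, hz₁, hmax, hjack⟩ := exists_jack_point hω hω0 (norm_pos_iff.2 hz0)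
    (mem_ball_zero_iff.1 hz)
  have hz₁R : z₁ ∈ ball (0 : ℂ) R := by rwa [mem_ball_zero_iff, hz₁, ← mem_ball_zero_iff]
  have hlt' : ‖z₁‖ < ‖ω z₁‖ := by
    rw [hz₁]
    exact hlt.trans_le (hmax z le_rfl)
  have hw0 : ω z₁ ≠ 0 := norm_pos_iff.1 ((norm_nonneg _).trans_lt hlt')
  obtain ⟨m, hm, hme⟩ := hjack hw0
  have hnhds := isOpen_ball.mem_nhds hz₁R
  have hdω := (hω.differentiableAt hnhds).hasDerivAt
  have hdp : HasDerivAt p (powAvgDeriv μ (ω z₁) * deriv ω z₁) z₁ := by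
    refine ((hasDerivAt_powAvg μ (hω1 z₁ hz₁R)).comp z₁ hdω).congr_of_eventuallyEq ?_
    filter_upwards [hnhds] with y hy using hp y hy
  have hkey := hpφ z₁ hz₁R
  rw [hdp.deriv, hp z₁ hz₁R] at hkey
  have hlt2 := re_powOneAdd_div_lt h0 h1 (hω1 z₁ hz₁R) ((hφ z₁ hz₁R).trans_lt hlt')
  have hpos := re_powAvgDeriv_div_powOneAdd_pos h0 h1 (hω1 z₁ hz₁R)
  set w := ω z₁
  have hE := powOneAdd_ne_zero (μ - 1) w
  have hid : powOneAdd μ (φ z₁) / (w * powOneAdd (μ - 1) w)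
      = powOneAdd μ w / (w * powOneAdd (μ - 1) w)
        + ((m - 1 : ℝ) : ℂ) * (powAvgDeriv μ w / powOneAdd (μ - 1) w) := by
    rw [← hkey, ← powAvg_add_mul_deriv μ (hω1 z₁ hz₁R)]
    have : z₁ * (powAvgDeriv μ w * deriv ω z₁) = powAvgDeriv μ w * (m * w) := by
      rw [← hme]
      ring
    rw [this]
    push_cast
    field_simp
    ring
  rw [hid, add_re, re_ofReal_mul] at hlt2
  nlinarith

/-- The **Hallenbeck–Ruscheweyh** subordination theorem for the convex function `(1 + w) ^ μ`. -/
theorem subord_powAvg {μ : ℝ} (h0 : 0 < μ) (h1 : μ ≤ 1) {p φ : ℂ → ℂ}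
    (hp : DifferentiableOn ℂ p (ball 0 1)) (hp0 : p 0 = 1)
    (hφ : ∀ z ∈ ball (0 : ℂ) 1, ‖φ z‖ ≤ ‖z‖)
    (hpφ : ∀ z ∈ ball (0 : ℂ) 1, p z + z * deriv p z = powOneAdd μ (φ z)) :
    Subord p (powAvg μ) := by
  have hF : DifferentiableOn ℂ (powAvg μ) (ball 0 1) := fun z hz =>
    (hasDerivAt_powAvg μ (mem_ball_zero_iff.1 hz)).differentiableAt.differentiableWithinAt
  have hF' : ∀ z ∈ ball (0 : ℂ) 1, deriv (powAvg μ) z ≠ 0 := fun z hz h => by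
    have := re_powAvgDeriv_pos h0 h1 (mem_ball_zero_iff.1 hz)
    rw [← (hasDerivAt_powAvg μ (mem_ball_zero_iff.1 hz)).deriv, h] at this
    simp at this
  have hinj := injOn_powAvg h0 h1
  set ω : ℂ → ℂ := Function.invFunOn (powAvg μ) (ball 0 1) ∘ p with hω
  have hω0 : ω 0 = 0 := by
    have h0mem : (0 : ℂ) ∈ ball (0 : ℂ) 1 := by simp
    rw [hω, Function.comp_apply, hp0, ← powAvg_zero μ]
    exact hinj.leftInvOn_invFunOn h0mem
  have hlift : ∀ z, p z ∈ powAvg μ '' ball 0 1 → ω z ∈ ball (0 : ℂ) 1 ∧ p z = powAvg μ (ω z) :=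
    fun z hz => ⟨Function.invFunOn_mem hz, (Function.invFunOn_eq hz).symm⟩
  have hdiff : ∀ z ∈ ball (0 : ℂ) 1, p z ∈ powAvg μ '' ball 0 1 → DifferentiableAt ℂ ω z := by
    intro z hz hpz
    obtain ⟨w, hw, hwp⟩ := hpz
    have := differentiableAt_invFunOn isOpen_ball hF hinj hw (hF' w hw)
    rw [hwp] at this
    exact this.comp z (hp.differentiableAt (isOpen_ball.mem_nhds hz))
  have hschwarz : ∀ R ≤ 1, (∀ z ∈ ball (0 : ℂ) R, p z ∈ powAvg μ '' ball 0 1) →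
      ∀ z ∈ ball (0 : ℂ) R, ‖ω z‖ ≤ ‖z‖ := by
    intro R hR hmem
    have hsub := ball_subset_ball (x := (0 : ℂ)) hR
    exact norm_le_of_powAvg_comp h0 h1
      (fun z hz => (hdiff z (hsub hz) (hmem z hz)).differentiableWithinAt)
      (fun z hz => mem_ball_zero_iff.1 (hlift z (hmem z hz)).1) hω0
      (fun z hz => (hlift z (hmem z hz)).2) (fun z hz => hφ z (hsub hz))
      (fun z hz => hpφ z (hsub hz))
  have himage : ∀ z ∈ ball (0 : ℂ) 1, p z ∈ powAvg μ '' ball 0 1 := by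
    by_contra! hbad
    obtain ⟨z₂, hz₂, hbad₂⟩ := hbad
    rw [mem_ball_zero_iff] at hz₂
    have hopen : IsOpen (powAvg μ '' ball 0 1) := by
      rw [isOpen_iff_mem_nhds]
      rintro _ ⟨w, hw, rfl⟩
      have hs : HasStrictDerivAt (powAvg μ) (deriv (powAvg μ) w) w :=
        (hF.analyticAt (isOpen_ball.mem_nhds hw)).hasStrictDerivAt
      rw [← hs.map_nhds_eq (hF' w hw)]
      exact Filter.image_mem_map (isOpen_ball.mem_nhds hw)
    -- a point of smallest norm that is sent outside the image of `powAvg`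
    have hK : IsCompact (closedBall (0 : ℂ) ‖z₂‖ ∩ p ⁻¹' (powAvg μ '' ball 0 1)ᶜ) := by
      refine (isCompact_closedBall (0 : ℂ) ‖z₂‖).of_isClosed_subset ?_ Set.inter_subset_left
      exact (hp.continuousOn.mono (closedBall_subset_ball hz₂)).preimage_isClosed_of_isClosed
        isClosed_closedBall hopen.isClosed_compl
    obtain ⟨z₀, ⟨hz₀, hz₀bad⟩, hmin⟩ := hK.exists_isMinOn ⟨z₂, by simp, hbad₂⟩
      continuous_norm.continuousOn
    rw [mem_closedBall_zero_iff] at hz₀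
    have hz₀1 : ‖z₀‖ < 1 := hz₀.trans_lt hz₂
    have hgood : ∀ z ∈ ball (0 : ℂ) ‖z₀‖, p z ∈ powAvg μ '' ball 0 1 := by
      intro z hz
      rw [mem_ball_zero_iff] at hz
      by_contra hc
      exact absurd (hmin ⟨mem_closedBall_zero_iff.2 (hz.le.trans hz₀), hc⟩) (not_le.2 hz)
    have hz₀0 : z₀ ≠ 0 := by
      rintro rfl
      exact hz₀bad ⟨0, by simp, by rw [powAvg_zero, hp0]⟩
    have hcomp : IsCompact (powAvg μ '' closedBall 0 ‖z₀‖) :=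
      (isCompact_closedBall (0 : ℂ) ‖z₀‖).image_of_continuousOn
        (hF.continuousOn.mono (closedBall_subset_ball hz₀1))
    have hmaps : Set.MapsTo p (ball 0 ‖z₀‖) (powAvg μ '' closedBall 0 ‖z₀‖) := by
      intro z hz
      refine ⟨ω z, ?_, (hlift z (hgood z hz)).2.symm⟩
      exact mem_closedBall_zero_iff.2 ((hschwarz _ hz₀1.le hgood z hz).trans
        (mem_ball_zero_iff.1 hz).le)
    have hcl : z₀ ∈ closure (ball (0 : ℂ) ‖z₀‖) := by
      rw [closure_ball _ (norm_ne_zero_iff.2 hz₀0)]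
      simp
    have hpz₀ : p z₀ ∈ closure (powAvg μ '' closedBall 0 ‖z₀‖) :=
      (hp.continuousOn.continuousAt (isOpen_ball.mem_nhds
        (mem_ball_zero_iff.2 hz₀1))).continuousWithinAt.mem_closure hcl hmaps
    rw [hcomp.isClosed.closure_eq] at hpz₀
    exact hz₀bad (Set.image_mono (closedBall_subset_ball hz₀1) hpz₀)
  exact ⟨ω, fun z hz => (hdiff z hz (himage z hz)).differentiableWithinAt,
    fun z hz => (hlift z (himage z hz)).1, hω0, fun z hz => (hlift z (himage z hz)).2⟩

/-- If `D` is zero-free with `Re (z D' / D) < μ / 2`, then `D` is subordinate to `(1 + w) ^ μ`. -/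
lemma exists_eq_powOneAdd {μ : ℝ} (h0 : 0 < μ) {D : ℂ → ℂ} (hD : DifferentiableOn ℂ D (ball 0 1))
    (hD0 : D 0 = 1) (hDne : ∀ z ∈ ball (0 : ℂ) 1, D z ≠ 0)
    (hre : ∀ z ∈ ball (0 : ℂ) 1, (z * deriv D z / D z).re < μ / 2) :
    ∃ φ : ℂ → ℂ, ∀ z ∈ ball (0 : ℂ) 1, ‖φ z‖ ≤ ‖z‖ ∧ D z = powOneAdd μ (φ z) := by
  have hμ : (μ : ℂ) ≠ 0 := by simpa using h0.ne'
  have h0mem : (0 : ℂ) ∈ ball (0 : ℂ) 1 := by simp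
  have hD' : ∀ z ∈ ball (0 : ℂ) 1, HasDerivAt D (deriv D z) z := fun z hz =>
    (hD.differentiableAt (isOpen_ball.mem_nhds hz)).hasDerivAt
  have hdD : DifferentiableOn ℂ (fun z => deriv D z / D z) (ball 0 1) :=
    (hD.deriv isOpen_ball).div hD hDne
  obtain ⟨L₀, hL₀⟩ := hdD.isExactOn_ball
  -- `M` is the branch of `log D / μ` that vanishes at `0`
  set M : ℂ → ℂ := fun z => (L₀ z - L₀ 0) / μ with hM
  have hM0 : M 0 = 0 := by simp [hM]
  have hM' : ∀ z ∈ ball (0 : ℂ) 1, HasDerivAt M (deriv D z / D z / μ) z := fun z hz =>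
    ((hL₀ z hz).sub_const _).div_const _
  have hDM : ∀ z ∈ ball (0 : ℂ) 1, D z = exp (μ * M z) := by
    have hder : ∀ z ∈ ball (0 : ℂ) 1, HasDerivAt (fun z => D z * exp (-(μ * M z))) 0 z := by
      intro z hz
      refine ((hD' z hz).mul ((hM' z hz).const_mul (μ : ℂ)).neg.cexp).congr_deriv ?_
      have := hDne z hz
      field_simp
      ring
    intro z hz
    have := isOpen_ball.is_const_of_deriv_eq_zero (convex_ball (0 : ℂ) 1).isPreconnected
      (fun y hy => (hder y hy).differentiableAt.differentiableWithinAt)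
      (fun y hy => (hder y hy).deriv) hz h0mem
    simp only [hM0, hD0, mul_zero, neg_zero, exp_zero, mul_one] at this
    rw [exp_neg] at this
    exact eq_of_mul_inv_eq_one this
  set φ : ℂ → ℂ := fun z => exp (M z) - 1 with hφ
  have hφ0 : φ 0 = 0 := by simp [hφ, hM0]
  have hφ' : ∀ z ∈ ball (0 : ℂ) 1, HasDerivAt φ (exp (M z) * (deriv D z / D z / μ)) z :=
    fun z hz => (hM' z hz).cexp.sub_const 1
  have hφd : DifferentiableOn ℂ φ (ball 0 1) := fun z hz =>
    (hφ' z hz).differentiableAt.differentiableWithinAt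
  have hφ1 : ∀ z ∈ ball (0 : ℂ) 1, ‖φ z‖ < 1 := by
    intro z hz
    by_contra! hge
    have hz0 : z ≠ 0 := by
      rintro rfl
      norm_num [hφ0] at hge
    obtain ⟨z₁, hz₁, hmax, hjack⟩ := exists_jack_point hφd hφ0 (norm_pos_iff.2 hz0)
      (mem_ball_zero_iff.1 hz)
    have hz₁b : z₁ ∈ ball (0 : ℂ) 1 := by rwa [mem_ball_zero_iff, hz₁, ← mem_ball_zero_iff]
    have hge' : 1 ≤ ‖φ z₁‖ := hge.trans (hmax z le_rfl)
    obtain ⟨m, hm, hme⟩ := hjack (norm_pos_iff.1 (zero_lt_one.trans_le hge'))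
    rw [(hφ' z₁ hz₁b).deriv] at hme
    have hE : exp (M z₁) = 1 + φ z₁ := by simp [hφ]
    have hne : 1 + φ z₁ ≠ 0 := hE ▸ exp_ne_zero _
    have hq : z₁ * deriv D z₁ / D z₁ = ((μ * m : ℝ) : ℂ) * (φ z₁ / (1 + φ z₁)) := by
      have := hDne z₁ hz₁b
      rw [hE] at hme
      push_cast
      rw [mul_assoc, mul_div_assoc', ← hme]
      field_simp
    have hlt := hre z₁ hz₁b
    rw [hq, re_ofReal_mul] at hlt
    have hhalf : 1 / 2 ≤ (φ z₁ / (1 + φ z₁)).re := by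
      have hn : 0 < normSq (1 + φ z₁) := normSq_pos.2 hne
      have h1 : 1 ≤ normSq (φ z₁) := by
        rw [normSq_eq_norm_sq]
        nlinarith
      rw [div_re, ← add_div, le_div_iff₀ hn]
      simp only [normSq_apply, add_re, add_im, one_re, one_im] at h1 ⊢
      nlinarith
    nlinarith [mul_le_mul_of_nonneg_left hm h0.le, mul_pos h0 (zero_lt_one.trans_le hm)]
  refine ⟨φ, fun z hz => ⟨?_, ?_⟩⟩
  · exact norm_le_norm_of_mapsTo_ball hφd
      (fun y hy => mem_closedBall_zero_iff.2 (hφ1 y hy).le) hφ0 (mem_ball_zero_iff.1 hz)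
  · have hlog : Set.EqOn (fun z => log (1 + φ z)) M (ball 0 1) := by
      have hd : ∀ y ∈ ball (0 : ℂ) 1,
          HasDerivAt (fun z => log (1 + φ z)) (deriv D y / D y / μ) y := by
        intro y hy
        refine (((hφ' y hy).const_add 1).clog
          (mem_slitPlane_of_norm_lt_one (hφ1 y hy))).congr_deriv ?_
        have hE : 1 + φ y = exp (M y) := by simp [hφ]
        rw [hE, mul_div_cancel_left₀ _ (exp_ne_zero _)]
      refine isOpen_ball.eqOn_of_deriv_eq (convex_ball (0 : ℂ) 1).isPreconnected
        (fun y hy => (hd y hy).differentiableAt.differentiableWithinAt)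
        (fun y hy => (hM' y hy).differentiableAt.differentiableWithinAt)
        (fun y hy => (hd y hy).deriv.trans (hM' y hy).deriv.symm) h0mem ?_
      simp [hφ0, hM0]
    rw [hDM z hz, ← hlog hz]
    rfl

/-- Let `0 < λ ≤ 1` and `f ∈ 𝒢(λ)` with `f'` not identically `1`. Then there
is an integer `n ≥ 1` such that the analytic extension of `f(z)/z` (with value `1` at `0`)
is subordinate on `𝔻` to `h_n(z) = (1/z) ∫_0^z (1+t^n)^{λ/n} dt` (with value `1` at `0`). -/
theorem stmt5 (lam : ℝ) (hlam0 : 0 < lam) (hlam1 : lam ≤ 1)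
    (f : ℂ → ℂ)
    (hf : DifferentiableOn ℂ f (ball 0 1))
    (hf0 : f 0 = 0) (hfd0 : deriv f 0 = 1)
    (hfd : ∀ z ∈ ball (0:ℂ) 1, deriv f z ≠ 0)
    (hG : ∀ z ∈ ball (0:ℂ) 1,
      (1 + z * deriv (deriv f) z / deriv f z).re < 1 + lam / 2)
    (hne1 : ¬ (∀ z ∈ ball (0:ℂ) 1, deriv f z = 1))
    (g : ℂ → ℂ)
    (hg0 : g 0 = 1)
    (hgval : ∀ z ∈ ball (0:ℂ) 1, z ≠ 0 → g z = f z / z) :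
    ∃ n : ℕ, 1 ≤ n ∧ Subord g (hFun lam n) := by
  have hD := hf.deriv isOpen_ball
  obtain ⟨φ, hφ⟩ := exists_eq_powOneAdd hlam0 hD hfd0 hfd (fun z hz => by
    have := hG z hz
    rw [add_re, one_re] at this
    linarith)
  have hgs : Set.EqOn g (dslope f 0) (ball 0 1) := by
    intro z hz
    rcases eq_or_ne z 0 with rfl | hz0
    · rw [hg0, dslope_same, hfd0]
    · rw [hgval z hz hz0, dslope_of_ne _ hz0, slope_def_field, hf0, sub_zero, sub_zero]
  have hgd : DifferentiableOn ℂ g (ball 0 1) :=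
    ((differentiableOn_dslope (isOpen_ball.mem_nhds (by simp))).2 hf).congr hgs
  have hfg : ∀ z ∈ ball (0 : ℂ) 1, f z = z * g z := by
    intro z hz
    rcases eq_or_ne z 0 with rfl | hz0
    · rw [hf0, zero_mul]
    · rw [hgval z hz hz0, mul_div_cancel₀ _ hz0]
  refine ⟨1, le_rfl, ?_⟩
  rw [hFun_one]
  refine subord_powAvg hlam0 hlam1 hgd hg0 (fun z hz => (hφ z hz).1) fun z hz => ?_
  have hnhds := isOpen_ball.mem_nhds hz
  have hder : HasDerivAt f (1 * g z + z * deriv g z) z := by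
    refine ((hasDerivAt_id z).mul (hgd.differentiableAt hnhds).hasDerivAt).congr_of_eventuallyEq ?_
    filter_upwards [hnhds] with y hy using hfg y hy
  rw [← (hφ z hz).2, hder.deriv, one_mul]
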